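/- arXiv:1706.08224 — 2 statements merged into one kernel-verified Lean document; each statement's English description precedes it below -/
import Mathlib

section
/- Let P be a probability distribution on a countable set Ω, let N > 0 and 0 < ρ ≤ 1, and suppose every point x in the support of P satisfies P(x) ≥ ρ/N. Let X_1, …, X_M be i.i.d. samples from P with (M−1)·ρ ≤ N. Then the probability that there is at least one collision among the M samples is at least 1 − exp(−M(M−1)ρ/(2N)). -/
open MeasureTheory in
theorem bp_aux_inj
    {Ω : Type*} [Countable Ω] [MeasurableSpace Ω] [MeasurableSingletonClass Ω]
    (P : PMF Ω) (c : ℝ) (hc : 0 ≤ c)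
    (hatom : ∀ x ∈ P.support, c ≤ (P x).toReal) (n : ℕ) :
    (Measure.pi fun _ : Fin n => P.toMeasure) {x | Function.Injective x} ≤
      ENNReal.ofReal (Real.exp (-((n : ℝ) * ((n : ℝ) - 1) / 2 * c))) := by
  induction n with
  | zero => simpa using prob_le_one
  | succ n ih =>
    have hmp := measurePreserving_piFinSuccAbove (fun _ : Fin (n+1) => P.toMeasure) 0
    set S : Set (Ω × (Fin n → Ω)) := {p | Function.Injective p.2 ∧ p.1 ∉ Set.range p.2} with hS
    have hSm : MeasurableSet S := MeasurableSet.of_discrete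
    have hpre : {x : Fin (n+1) → Ω | Function.Injective x} =
        (MeasurableEquiv.piFinSuccAbove (fun _ : Fin (n+1) => Ω) 0) ⁻¹' S := by
      ext x
      obtain ⟨a, y, rfl⟩ : ∃ a y, x = Fin.cons a y := ⟨x 0, Fin.tail x, by simp⟩
      simp only [Set.mem_setOf_eq, Set.mem_preimage, hS, Fin.cons_injective_iff]
      rw [and_comm]
      rfl
    rw [hpre, hmp.measure_preimage hSm.nullMeasurableSet, Measure.prod_apply_symm hSm]
    have hsupp : ∀ᵐ y ∂(Measure.pi fun _ : Fin n => P.toMeasure), ∀ i, y i ∈ P.support := by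
      rw [ae_all_iff]
      intro i
      have h0 : ∀ᵐ a ∂P.toMeasure, a ∈ P.support := by
        rw [ae_iff, PMF.toMeasure_apply_eq_zero_iff _ MeasurableSet.of_discrete]
        rw [Set.disjoint_left]
        intro a ha hb
        exact hb ha
      exact (Measure.tendsto_eval_ae_ae (μ := fun _ : Fin n => P.toMeasure) (i := i)).eventually h0
    calc _ ≤ ∫⁻ y, Set.indicator {x | Function.Injective x}
              (fun _ => ENNReal.ofReal (1 - n * c)) y ∂(Measure.pi fun _ : Fin n => P.toMeasure) := by
            apply lintegral_mono_ae
            filter_upwards [hsupp] with y hy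
            by_cases hi : Function.Injective y
            · rw [Set.indicator_of_mem (by exact hi)]
              classical
              have e : ((fun x => (x, y)) ⁻¹' S) = ((Finset.univ.image y : Finset Ω) : Set Ω)ᶜ := by
                ext a; simp [hS, hi]
              rw [e, prob_compl_eq_one_sub MeasurableSet.of_discrete,
                PMF.toMeasure_apply_finset, Finset.sum_image (fun a _ b _ h => hi h),
                ENNReal.ofReal_sub _ (by positivity), ENNReal.ofReal_one]
              refine tsub_le_tsub_left ?_ _
              calc ENNReal.ofReal (n * c) = ∑ i : Fin n, ENNReal.ofReal c := by
                    simp [ENNReal.ofReal_mul]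
                _ ≤ _ := Finset.sum_le_sum fun i _ =>
                    ENNReal.ofReal_le_of_le_toReal (hatom _ (hy i))
            · have e : ((fun x => (x, y)) ⁻¹' S) = ∅ := by
                ext a; simp [hS, hi]
              rw [e]; simp
      _ = ENNReal.ofReal (1 - n * c) *
            (Measure.pi fun _ : Fin n => P.toMeasure) {x | Function.Injective x} := by
            rw [lintegral_indicator_const MeasurableSet.of_discrete]
      _ ≤ ENNReal.ofReal (Real.exp (-(n * c))) *
            ENNReal.ofReal (Real.exp (-((n : ℝ) * ((n : ℝ) - 1) / 2 * c))) := by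
            gcongr
            exact Real.one_sub_le_exp_neg _
      _ = _ := by
            rw [← ENNReal.ofReal_mul (Real.exp_pos _).le, ← Real.exp_add]
            congr 2
            push_cast
            ring


/-- **Birthday paradox lower bound (exponential form, Theorem 1 of the paper).**
If every atom of a probability distribution `P` on a countable set `Ω` has mass at least
`ρ / N`, and `X_1, …, X_M` are i.i.d. samples from `P` with `(M-1)·ρ ≤ N`, then the
probability of at least one collision among the samples is at least
`1 - exp(-M(M-1)ρ/(2N))`. -/
theorem birthday_paradox_collision_exp_bound
    {Ω : Type*} [Countable Ω] [MeasurableSpace Ω] [MeasurableSingletonClass Ω]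
    (P : PMF Ω) (N ρ : ℝ) (hN : 0 < N) (hρ0 : 0 < ρ) (hρ1 : ρ ≤ 1)
    (hatom : ∀ x ∈ P.support, ρ / N ≤ (P x).toReal)
    (M : ℕ) (hM : ((M : ℝ) - 1) * ρ ≤ N) :
    ENNReal.ofReal (1 - Real.exp (-((M : ℝ) * ((M : ℝ) - 1) * ρ / (2 * N)))) ≤
      (MeasureTheory.Measure.pi fun _ : Fin M => P.toMeasure)
        {x | ∃ i j, i ≠ j ∧ x i = x j} := by
  have h := bp_aux_inj P (ρ / N) (by positivity) hatom M
  have e : {x : Fin M → Ω | ∃ i j, i ≠ j ∧ x i = x j} = {x | Function.Injective x}ᶜ := by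
    ext x
    simp only [Set.mem_setOf_eq, Set.mem_compl_iff, Function.Injective]
    push Not
    exact ⟨fun ⟨i, j, h1, h2⟩ => ⟨i, j, h2, h1⟩, fun ⟨i, j, h1, h2⟩ => ⟨i, j, h2, h1⟩⟩
  have hm : MeasurableSet {x : Fin M → Ω | Function.Injective x} := by
    exact MeasurableSet.of_discrete
  rw [e, MeasureTheory.prob_compl_eq_one_sub hm, ENNReal.ofReal_sub _ (Real.exp_pos _).le,
    ENNReal.ofReal_one]
  refine tsub_le_tsub_left (h.trans (le_of_eq ?_)) _
  congr 3
  field_simp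
end

section
/- Let M ≥ 1 be a real number, let β > 0, and let γ ∈ (0, 1). If exp(−M²/(2β) − M³/(6β²)) ≤ 1 − γ, then β ≤ 2M / (−3 + √(9 + (24/M)·ln(1/(1−γ)))). -/
/-- **Derivation of the upper bound `β*` in the proof of Theorem 2 of the paper.**
For a real number `M ≥ 1`, `β > 0` and `γ ∈ (0,1)`, if
`exp(-M²/(2β) - M³/(6β²)) ≤ 1 - γ`, then
`β ≤ 2M / (-3 + √(9 + (24/M)·ln(1/(1-γ))))`. -/
theorem beta_upper_bound_of_exp_ineq
    (M β γ : ℝ) (hM : 1 ≤ M) (hβ : 0 < β) (hγ0 : 0 < γ) (hγ1 : γ < 1)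
    (h : Real.exp (-(M ^ 2 / (2 * β)) - M ^ 3 / (6 * β ^ 2)) ≤ 1 - γ) :
    β ≤ 2 * M / (-3 + Real.sqrt (9 + (24 / M) * Real.log (1 / (1 - γ)))) := by
  have hg : 0 < 1 - γ := by linarith
  have hM0 : 0 < M := by linarith
  have h1 := (Real.le_log_iff_exp_le hg).2 h
  have hlog : Real.log (1 / (1 - γ)) = -Real.log (1 - γ) := by
    rw [one_div, Real.log_inv]
  have hneg : Real.log (1 - γ) < 0 := Real.log_neg hg (by linarith)
  rw [hlog]
  generalize Real.log (1 - γ) = l at *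
  have hpos : 0 < 24 / M * (-l) := mul_pos (by positivity) (by linarith)
  have hs : 3 < Real.sqrt (9 + 24 / M * (-l)) :=
    Real.lt_sqrt_of_sq_lt (by linarith)
  have hle : Real.sqrt (9 + 24 / M * (-l)) ≤ 3 + 2 * M / β := by
    apply Real.sqrt_le_iff.2
    refine ⟨by positivity, ?_⟩
    have h2 : 24 / M * (-l) ≤ 24 / M * (M ^ 2 / (2 * β) + M ^ 3 / (6 * β ^ 2)) :=
      mul_le_mul_of_nonneg_left (by linarith) (by positivity)
    have h3 : 9 + 24 / M * (M ^ 2 / (2 * β) + M ^ 3 / (6 * β ^ 2)) = (3 + 2 * M / β) ^ 2 := by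
      field_simp
      ring
    linarith
  rw [le_div_iff₀ (by linarith), mul_comm, ← le_div_iff₀ hβ]
  linarith
end
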